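/- arXiv:1508.03187 — 9 statements merged into one kernel-verified Lean document; each statement's English description precedes it below -/
import Mathlib

section
/- For every natural number n, every closed subspace of the n-th power 𝕊ⁿ of the Sorgenfrey line is a Baire space. That is, if F is a subset of (Fin n → ℝₗ) that is closed in the product of Sorgenfrey topologies, then F with its subspace topology is a Baire space. -/
open Topology Set

/-- The Sorgenfrey topology on ℝ, generated by half-open intervals `[a, b)`. -/
def sorgTop : TopologicalSpace ℝ :=
  TopologicalSpace.generateFrom {s : Set ℝ | ∃ a b : ℝ, s = Set.Ico a b}

/-- The Sorgenfrey plane topology on ℝ × ℝ: the product of two Sorgenfrey topologies. -/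
def sorgPlane : TopologicalSpace (ℝ × ℝ) := @instTopologicalSpaceProd ℝ ℝ sorgTop sorgTop

/-- `A` and `B` are completely separated in `(X, t)`. -/
def CompletelySeparatedIn {X : Type*} (t : TopologicalSpace X) (A B : Set X) : Prop :=
  ∃ f : X → ℝ, Continuous[t, inferInstance] f ∧ (∀ x, f x ∈ Set.Icc (0:ℝ) 1) ∧
    (∀ x ∈ A, f x = 0) ∧ (∀ x ∈ B, f x = 1)

/-- `A` is functionally closed (a zero-set) in `(X, t)`. -/
def FunctionallyClosedIn {X : Type*} (t : TopologicalSpace X) (A : Set X) : Prop :=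
  ∃ f : X → ℝ, Continuous[t, inferInstance] f ∧ (∀ x, f x ∈ Set.Icc (0:ℝ) 1) ∧
    A = f ⁻¹' {0}

/-- `E` is C*-embedded in `(X, t)`: every bounded continuous real function on `E`
(with the subspace topology) extends continuously to `X`. -/
def CStarEmbedded {X : Type*} (t : TopologicalSpace X) (E : Set X) : Prop :=
  ∀ f : E → ℝ, Continuous[t.induced ((↑) : E → X), inferInstance] f →
    (∃ M : ℝ, ∀ x, |f x| ≤ M) →
    ∃ g : X → ℝ, Continuous[t, inferInstance] g ∧ ∀ x : E, g x = f x

/-- `E` is C-embedded in `(X, t)`: every continuous real function on `E`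
(with the subspace topology) extends continuously to `X`. -/
def CEmbedded {X : Type*} (t : TopologicalSpace X) (E : Set X) : Prop :=
  ∀ f : E → ℝ, Continuous[t.induced ((↑) : E → X), inferInstance] f →
    ∃ g : X → ℝ, Continuous[t, inferInstance] g ∧ ∀ x : E, g x = f x

/-- `E` is z-embedded in `(X, t)`: every functionally closed subset of `E` is the trace
on `E` of a functionally closed subset of `X`. -/
def ZEmbedded {X : Type*} (t : TopologicalSpace X) (E : Set X) : Prop :=
  ∀ Z : Set E, FunctionallyClosedIn (t.induced ((↑) : E → X)) Z →
    ∃ W : Set X, FunctionallyClosedIn t W ∧ ((↑) : E → X) ⁻¹' W = Z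

/-- The half-open cube with lower corner `c` and side `δ`. -/
def rightCube {ι : Type*} (c : ι → ℝ) (δ : ℝ) : Set (ι → ℝ) :=
  {x | ∀ i, x i ∈ Ico (c i) (c i + δ)}

lemma self_mem_rightCube {ι : Type*} (c : ι → ℝ) {δ : ℝ} (hδ : 0 < δ) : c ∈ rightCube c δ :=
  fun i => ⟨le_rfl, by linarith⟩

lemma rightCube_mono {ι : Type*} (c : ι → ℝ) {δ ε : ℝ} (h : δ ≤ ε) :
    rightCube c δ ⊆ rightCube c ε :=
  fun _ hx i => ⟨(hx i).1, by linarith [(hx i).2]⟩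

lemma exists_pos_forall_le {ι : Type*} [Finite ι] {f : ι → ℝ} (hf : ∀ i, 0 < f i) :
    ∃ ε > 0, ∀ i, ε ≤ f i := by
  cases isEmpty_or_nonempty ι
  · exact ⟨1, one_pos, isEmptyElim⟩
  · obtain ⟨i, hi⟩ := Finite.exists_min f
    exact ⟨f i, hf i, hi⟩

lemma exists_rightCube_subset {ι : Type*} [Finite ι] {a c : ι → ℝ} {ε : ℝ}
    (hc : c ∈ rightCube a ε) : ∃ δ > 0, rightCube c δ ⊆ rightCube a ε := by
  obtain ⟨δ, hδ, h⟩ := exists_pos_forall_le (f := fun i => a i + ε - c i)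
    fun i => sub_pos.2 (hc i).2
  exact ⟨δ, hδ, fun x hx i => ⟨(hc i).1.trans (hx i).1, by linarith [(hx i).2, h i]⟩⟩

lemma exists_Ico_subset_of_isOpen_sorgTop {U : Set ℝ} (hU : IsOpen[sorgTop] U) {x : ℝ}
    (hx : x ∈ U) : ∃ ε > 0, Ico x (x + ε) ⊆ U := by
  induction hU with
  | basic s hs =>
    obtain ⟨a, b, rfl⟩ := hs
    exact ⟨b - x, sub_pos.2 hx.2, fun y hy => ⟨hx.1.trans hy.1, by linarith [hy.2]⟩⟩
  | univ => exact ⟨1, one_pos, subset_univ _⟩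
  | inter s t _ _ hs ht =>
    obtain ⟨ε, hε, h⟩ := hs hx.1
    obtain ⟨δ, hδ, h'⟩ := ht hx.2
    exact ⟨min ε δ, lt_min hε hδ, fun y hy =>
      ⟨h ⟨hy.1, by linarith [hy.2, min_le_left ε δ]⟩,
        h' ⟨hy.1, by linarith [hy.2, min_le_right ε δ]⟩⟩⟩
  | sUnion S _ h =>
    obtain ⟨s, hs, hxs⟩ := hx
    obtain ⟨ε, hε, h'⟩ := h s hs hxs
    exact ⟨ε, hε, h'.trans (subset_sUnion_of_mem hs)⟩

lemma exists_rightCube_subset_of_isOpen {ι : Type*} [Finite ι] {U : Set (ι → ℝ)}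
    (hU : IsOpen[@Pi.topologicalSpace ι (fun _ => ℝ) (fun _ => sorgTop)] U) {x : ι → ℝ}
    (hx : x ∈ U) : ∃ ε > 0, rightCube x ε ⊆ U := by
  obtain ⟨u, hu, hsub⟩ := (@isOpen_pi_iff' ι (fun _ => ℝ) (fun _ => sorgTop) _ U).1 hU x hx
  choose f hf h using fun i => exists_Ico_subset_of_isOpen_sorgTop (hu i).1 (hu i).2
  obtain ⟨ε, hε, hle⟩ := exists_pos_forall_le hf
  exact ⟨ε, hε, fun y hy => hsub fun i _ => h i ⟨(hy i).1, by linarith [(hy i).2, hle i]⟩⟩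

lemma isOpen_rightCube {ι : Type*} [Finite ι] (c : ι → ℝ) (δ : ℝ) :
    IsOpen[@Pi.topologicalSpace ι (fun _ => ℝ) (fun _ => sorgTop)] (rightCube c δ) := by
  have h := @isOpen_set_pi ι (fun _ => ℝ) (fun _ => sorgTop) univ
    (fun i => Ico (c i) (c i + δ)) finite_univ
    fun i _ => TopologicalSpace.isOpen_generateFrom_of_mem ⟨_, _, rfl⟩
  convert h using 1
  ext x
  simp [rightCube]

/-- A closed set in a power of the Sorgenfrey line contains the infima of its decreasing
sequences. -/
lemma iInf_mem_of_antitone {ι : Type*} [Finite ι] {F : Set (ι → ℝ)}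
    (hF : IsClosed[@Pi.topologicalSpace ι (fun _ => ℝ) (fun _ => sorgTop)] F)
    {b : ℕ → ι → ℝ} (hb : Antitone b) (hbdd : BddBelow (range b)) (hbF : ∀ k, b k ∈ F) :
    (⨅ k, b k) ∈ F := by
  by_contra hy
  obtain ⟨ε, hε, h⟩ := exists_rightCube_subset_of_isOpen
    ((@isOpen_compl_iff _ F (@Pi.topologicalSpace ι (fun _ => ℝ) (fun _ => sorgTop))).2 hF) hy
  have hlim := tendsto_pi_nhds.1 (tendsto_atTop_ciInf hb hbdd)
  have hev : ∀ᶠ k in Filter.atTop, ∀ i, b k i < (⨅ k, b k) i + ε :=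
    Filter.eventually_all.2 fun i => (hlim i).eventually_lt_const (by linarith)
  obtain ⟨k, hk⟩ := hev.exists
  exact h (fun i => ⟨ciInf_le hbdd k i, hk i⟩) (hbF k)

/-- Arbitrarily close to `c` there are points of `F` which are upper bounds of a neighbourhood
of `c` in `F`. -/
def HasLocalUpperBounds {ι : Type*} (F : Set (ι → ℝ)) (c : ι → ℝ) : Prop :=
  ∀ δ > 0, ∃ b ∈ F, b ∈ rightCube c δ ∧ ∃ η > 0, ∀ x ∈ F, x ∈ rightCube c η → x ≤ b

open Classical in
lemma exists_hasLocalUpperBounds_of_card_le {ι : Type*} [Fintype ι] (F : Set (ι → ℝ)) (k : ℕ) :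
    ∀ a ∈ F, ∀ ε > 0, (∀ x ∈ F, x ∈ rightCube a ε → Finset.card {i | a i < x i} ≤ k) →
      ∃ c ∈ F, c ∈ rightCube a ε ∧ HasLocalUpperBounds F c := by
  induction k using Nat.strong_induction_on with
  | _ k ih =>
  intro a ha ε hε hk
  by_cases hex : ∃ c ∈ F, c ∈ rightCube a ε ∧ ∃ δ > 0,
      ∀ x ∈ F, x ∈ rightCube c δ → Finset.card {i | c i < x i} < k
  · obtain ⟨c, hc, hca, δ, hδ, h⟩ := hex
    obtain ⟨η, hη, hsub⟩ := exists_rightCube_subset hca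
    have hk0 : 0 < k := (Nat.zero_le _).trans_lt (h c hc (self_mem_rightCube c hδ))
    obtain ⟨d, hd, hdc, hP⟩ := ih (k - 1) (by omega) c hc (min δ η) (lt_min hδ hη) fun x hx hxc =>
      Nat.le_sub_one_of_lt (h x hx (rightCube_mono c (min_le_left _ _) hxc))
    exact ⟨d, hd, hsub (rightCube_mono c (min_le_right _ _) hdc), hP⟩
  · push Not at hex
    obtain ⟨b, hb, hba, hbk⟩ := hex a ha (self_mem_rightCube a hε) ε hε
    obtain ⟨η, hη, hsub⟩ := exists_rightCube_subset hba
    have hfix : ∀ x ∈ F, x ∈ rightCube b η → ∀ i, b i < x i → a i < b i := by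
      intro x hx hxb i hi
      have hss : (Finset.univ.filter fun i => a i < b i) ⊆ Finset.univ.filter fun i => a i < x i :=
        Finset.monotone_filter_right _ fun j _ hj => hj.trans_le (hxb j).1
      have heq := Finset.eq_of_subset_of_card_le hss ((hk x hx (hsub hxb)).trans hbk)
      have hmem : i ∈ Finset.univ.filter fun i => a i < x i := by
        simpa using (hba i).1.trans_lt hi
      rw [← heq] at hmem
      simpa using hmem
    refine ⟨b, hb, hba, fun δ hδ => ?_⟩
    obtain ⟨x, hx, hxb, hxk⟩ := hex b hb hba (min δ η) (lt_min hδ hη)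
    have hxη := rightCube_mono b (min_le_right _ _) hxb
    have hlt : ∀ i, a i < b i → b i < x i := by
      intro i hi
      have hss : (Finset.univ.filter fun i => b i < x i) ⊆ Finset.univ.filter fun i => a i < b i :=
        Finset.monotone_filter_right _ fun j _ hj => hfix x hx hxη j hj
      have heq := Finset.eq_of_subset_of_card_le hss ((hk b hb hba).trans hxk)
      have hmem : i ∈ Finset.univ.filter fun i => a i < b i := by simpa using hi
      rw [← heq] at hmem
      simpa using hmem
    obtain ⟨θ, hθ, hθle⟩ := exists_pos_forall_le
      (f := fun i => if b i < x i then x i - b i else 1) fun i => by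
        split_ifs with h
        · exact sub_pos.2 h
        · exact one_pos
    refine ⟨x, hx, rightCube_mono b (min_le_left _ _) hxb, min θ η, lt_min hθ hη, ?_⟩
    intro y hy hyb i
    have hyη := rightCube_mono b (min_le_right _ _) hyb
    by_cases hi : b i < y i
    · have hbx := hlt i (hfix y hy hyη i hi)
      have h1 := hθle i
      rw [if_pos hbx] at h1
      linarith [(hyb i).2, min_le_left θ η]
    · exact (not_lt.1 hi).trans (hxη i).1

lemma exists_hasLocalUpperBounds {ι : Type*} [Finite ι] {F : Set (ι → ℝ)} {a : ι → ℝ}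
    (ha : a ∈ F) {ε : ℝ} (hε : 0 < ε) :
    ∃ c ∈ F, c ∈ rightCube a ε ∧ HasLocalUpperBounds F c := by
  have := Fintype.ofFinite ι
  exact exists_hasLocalUpperBounds_of_card_le F (Fintype.card ι) a ha ε hε
    fun _ _ _ => Finset.card_le_univ _

/-- Inside any cube there is an order interval with endpoints in `F`, contained in a given
dense open subset of `F` and containing a smaller cube relative to `F`. -/
lemma exists_Icc_subset_of_dense {ι : Type*} [Finite ι] {F D : Set (ι → ℝ)}
    (hopen : ∀ x ∈ F, x ∈ D → ∃ η > 0, F ∩ rightCube x η ⊆ D)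
    (hdense : ∀ x ∈ F, ∀ ε > 0, ∃ y ∈ F, y ∈ rightCube x ε ∧ y ∈ D)
    {a : ι → ℝ} (ha : a ∈ F) {ε : ℝ} (hε : 0 < ε) :
    ∃ c ∈ F, ∃ b ∈ F, ∃ δ > 0, F ∩ Icc c b ⊆ D ∩ rightCube a ε ∧
      F ∩ rightCube c δ ⊆ Icc c b := by
  obtain ⟨d, hd, hda, hdD⟩ := hdense a ha ε hε
  obtain ⟨η, hη, hsub⟩ := exists_rightCube_subset hda
  obtain ⟨θ, hθ, hD⟩ := hopen d hd hdD
  obtain ⟨c, hc, hcd, hP⟩ := exists_hasLocalUpperBounds hd (lt_min hη hθ)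
  obtain ⟨ζ, hζ, hsub'⟩ := exists_rightCube_subset hcd
  obtain ⟨b, hb, hbc, δ, hδ, h⟩ := hP ζ hζ
  refine ⟨c, hc, b, hb, δ, hδ, fun x hx => ?_, fun x hx => ⟨fun i => (hx.2 i).1, h x hx.1 hx.2⟩⟩
  have hxd := hsub' (fun i => ⟨hx.2.1 i, (hx.2.2 i).trans_lt (hbc i).2⟩ : x ∈ rightCube c ζ)
  exact ⟨hD ⟨hx.1, rightCube_mono d (min_le_right _ _) hxd⟩,
    hsub (rightCube_mono d (min_le_left _ _) hxd)⟩

lemma exists_mem_rightCube_forall_mem {ι : Type*} [Finite ι] {F : Set (ι → ℝ)}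
    (hF : IsClosed[@Pi.topologicalSpace ι (fun _ => ℝ) (fun _ => sorgTop)] F)
    {D : ℕ → Set (ι → ℝ)}
    (hopen : ∀ k, ∀ x ∈ F, x ∈ D k → ∃ η > 0, F ∩ rightCube x η ⊆ D k)
    (hdense : ∀ k, ∀ x ∈ F, ∀ ε > 0, ∃ y ∈ F, y ∈ rightCube x ε ∧ y ∈ D k)
    {a : ι → ℝ} (ha : a ∈ F) {ε : ℝ} (hε : 0 < ε) :
    ∃ y ∈ F, y ∈ rightCube a ε ∧ ∀ k, y ∈ D k := by
  choose! c hc b hb δ hδ hsub hcube using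
    fun k (p : (ι → ℝ) × ℝ) (hp : p.1 ∈ F ∧ 0 < p.2) =>
      exists_Icc_subset_of_dense (hopen k) (hdense k) hp.1 hp.2
  let s : ℕ → (ι → ℝ) × ℝ := fun k => Nat.rec (a, ε) (fun k p => (c k p, δ k p)) k
  have hs : ∀ k, (s k).1 ∈ F ∧ 0 < (s k).2 := by
    intro k
    induction k with
    | zero => exact ⟨ha, hε⟩
    | succ k ih => exact ⟨hc k _ ih, hδ k _ ih⟩
  have hcb : ∀ k, c k (s k) ≤ b k (s k) := fun k =>
    (hcube k _ (hs k) ⟨hc k _ (hs k), self_mem_rightCube _ (hδ k _ (hs k))⟩).2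
  have hstep : ∀ k, F ∩ Icc (c (k + 1) (s (k + 1))) (b (k + 1) (s (k + 1))) ⊆
      Icc (c k (s k)) (b k (s k)) := fun k x hx =>
    hcube k _ (hs k) ⟨hx.1, (hsub (k + 1) _ (hs (k + 1)) hx).2⟩
  have hcmono : Monotone fun k => c k (s k) := monotone_nat_of_le_succ fun k =>
    (hstep k ⟨hc (k + 1) _ (hs (k + 1)), le_rfl, hcb _⟩).1
  have hbanti : Antitone fun k => b k (s k) := antitone_nat_of_succ_le fun k =>
    (hstep k ⟨hb (k + 1) _ (hs (k + 1)), hcb _, le_rfl⟩).2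
  have hle : ∀ k l, c k (s k) ≤ b l (s l) := fun k l =>
    (hcmono (le_max_left k l)).trans ((hcb _).trans (hbanti (le_max_right k l)))
  have hbdd : BddBelow (range fun k => b k (s k)) :=
    ⟨c 0 (s 0), forall_mem_range.2 fun l => hle 0 l⟩
  have hyF := iInf_mem_of_antitone hF hbanti hbdd fun k => hb k _ (hs k)
  have hy : ∀ k, (⨅ l, b l (s l)) ∈ D k ∩ rightCube (s k).1 (s k).2 := fun k =>
    hsub k _ (hs k) ⟨hyF, le_ciInf fun l => hle k l, ciInf_le hbdd k⟩
  exact ⟨_, hyF, (hy 0).2, fun k => (hy k).1⟩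

/-- Every closed subspace of the n-th power of the Sorgenfrey line is a Baire space. -/
theorem closed_subspace_of_sorgenfrey_power_isBaire (n : ℕ) (F : Set (Fin n → ℝ))
    (hF : IsClosed[@Pi.topologicalSpace (Fin n) (fun _ => ℝ) (fun _ => sorgTop)] F) :
    @BaireSpace F
      ((@Pi.topologicalSpace (Fin n) (fun _ => ℝ) (fun _ => sorgTop)).induced
        ((↑) : F → (Fin n → ℝ))) := by
  let τ : TopologicalSpace F :=
    (@Pi.topologicalSpace (Fin n) (fun _ => ℝ) (fun _ => sorgTop)).induced (↑)
  have hnhd : ∀ {U : Set F}, IsOpen[τ] U → ∀ x ∈ U,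
      ∃ ε > 0, ∀ y : F, (y : Fin n → ℝ) ∈ rightCube (x : Fin n → ℝ) ε → y ∈ U := by
    rintro U ⟨O, hO, rfl⟩ x hx
    obtain ⟨ε, hε, h⟩ := exists_rightCube_subset_of_isOpen hO hx
    exact ⟨ε, hε, fun y hy => h hy⟩
  refine @BaireSpace.mk F τ fun f hfo hfd => ?_
  refine dense_iff_inter_open.2 fun U hU ⟨x, hx⟩ => ?_
  obtain ⟨ε, hε, hεU⟩ := hnhd hU x hx
  have hopen : ∀ k, ∀ z ∈ F, z ∈ Subtype.val '' f k →
      ∃ η > 0, F ∩ rightCube z η ⊆ Subtype.val '' f k := by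
    rintro k _ - ⟨z, hz, rfl⟩
    obtain ⟨η, hη, h⟩ := hnhd (hfo k) z hz
    exact ⟨η, hη, fun w hw => ⟨⟨w, hw.1⟩, h _ hw.2, rfl⟩⟩
  have hdense : ∀ k, ∀ z ∈ F, ∀ η > 0,
      ∃ w ∈ F, w ∈ rightCube z η ∧ w ∈ Subtype.val '' f k := by
    intro k z hz η hη
    obtain ⟨w, hwz, hw⟩ := (hfd k).inter_open_nonempty (Subtype.val ⁻¹' rightCube z η)
      ⟨_, isOpen_rightCube z η, rfl⟩ ⟨⟨z, hz⟩, self_mem_rightCube z hη⟩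
    exact ⟨w, w.2, hwz, w, hw, rfl⟩
  obtain ⟨y, hyF, hyx, hy⟩ := exists_mem_rightCube_forall_mem hF hopen hdense x.2 hε
  refine ⟨⟨y, hyF⟩, hεU _ hyx, mem_iInter.2 fun k => ?_⟩
  simpa [hyF] using hy k
end

section
/- A set E ⊆ ℝ² is functionally closed in the Sorgenfrey plane 𝕊² if and only if both of the following hold: (1) E is a Gδ-set in the Euclidean topology of ℝ²; and (2) for every set F ⊆ ℝ² that is closed in the Euclidean topology and disjoint from E, the sets F and E are completely separated in 𝕊². -/
open Topology Set

theorem nhds_sorgTop (x : ℝ) : @nhds ℝ sorgTop x = 𝓝[≥] x := by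
  rw [sorgTop, TopologicalSpace.nhds_generateFrom]
  apply le_antisymm
  · rw [(nhdsGE_basis x).ge_iff]
    intro b hb
    exact Filter.mem_iInf_of_mem (Ico x b)
      (Filter.mem_iInf_of_mem ⟨left_mem_Ico.2 hb, x, b, rfl⟩ (Filter.mem_principal_self _))
  · simp only [le_iInf_iff, Filter.le_principal_iff]
    rintro _ ⟨hx, a, b, rfl⟩
    exact Filter.mem_of_superset (Ico_mem_nhdsGE hx.2) (Ico_subset_Ico_left hx.1)

theorem nhds_sorgPlane (p : ℝ × ℝ) : @nhds (ℝ × ℝ) sorgPlane p = 𝓝[≥] p := by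
  obtain ⟨x, y⟩ := p
  rw [sorgPlane, @nhds_prod_eq ℝ ℝ sorgTop sorgTop, nhds_sorgTop, nhds_sorgTop,
    ← nhdsWithin_prod_eq, Ici_prod_Ici]

theorem continuous_sorgPlane_iff {f : ℝ × ℝ → ℝ} :
    Continuous[sorgPlane, inferInstance] f ↔ ∀ p, ContinuousWithinAt f (Ici p) p := by
  rw [@continuous_iff_continuousAt _ _ sorgPlane]
  simp only [ContinuousAt, nhds_sorgPlane, ContinuousWithinAt]

theorem Continuous.continuous_sorgPlane {f : ℝ × ℝ → ℝ} (hf : Continuous f) :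
    Continuous[sorgPlane, inferInstance] f :=
  continuous_sorgPlane_iff.2 fun _ => hf.continuousWithinAt

/-- A uniform lower bound for `f` on north-east quadrants of a fixed size passes to Euclidean
limits of their corners. -/
theorem le_of_mem_closure_quadrant {f : ℝ × ℝ → ℝ}
    (hf : ∀ p, ContinuousWithinAt f (Ici p) p) {c ε : ℝ} (hε : 0 < ε) {p : ℝ × ℝ}
    (hp : p ∈ closure {p | ∀ q, p ≤ q → dist q p < ε → c ≤ f q}) : c ≤ f p := by
  obtain ⟨x, y⟩ := p
  have hsub : Ioi x ×ˢ Ioi y ⊆ Ici (x, y) := fun q hq => ⟨le_of_lt hq.1, le_of_lt hq.2⟩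
  have : (𝓝[Ioi x ×ˢ Ioi y] (x, y)).NeBot := by
    rw [nhdsWithin_prod_eq]
    infer_instance
  refine ge_of_tendsto ((hf (x, y)).mono hsub) ?_
  filter_upwards [self_mem_nhdsWithin, mem_nhdsWithin_of_mem_nhds (Metric.ball_mem_nhds _ hε)]
    with q hq hqε
  have hle : ∀ᶠ r in 𝓝 (x, y), r ≤ q :=
    ((continuous_fst.tendsto (x, y)).eventually (eventually_le_nhds hq.1)).and
      ((continuous_snd.tendsto (x, y)).eventually (eventually_le_nhds hq.2))
  have hdist : ∀ᶠ r in 𝓝 (x, y), dist q r < ε :=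
    (continuous_const.dist continuous_id).tendsto (x, y) |>.eventually (gt_mem_nhds hqε)
  obtain ⟨r, hr, hrq, hrε⟩ := ((mem_closure_iff_frequently.1 hp).and_eventually
    (hle.and hdist)).exists
  exact hr q hrq hrε

theorem isGδ_preimage_zero_of_continuous_sorgPlane {f : ℝ × ℝ → ℝ}
    (hf : Continuous[sorgPlane, inferInstance] f) (hf0 : ∀ p, 0 ≤ f p) :
    IsGδ (f ⁻¹' {0}) := by
  rw [continuous_sorgPlane_iff] at hf
  let U : ℕ → Set (ℝ × ℝ) := fun n =>
    {p | ∀ q, p ≤ q → dist q p < 1 / ((n : ℝ) + 1) → 1 / ((n : ℝ) + 1) ≤ f q}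
  have hU : f ⁻¹' {0} = ⋂ n, (closure (U n))ᶜ := by
    ext p
    simp only [mem_preimage, mem_singleton_iff, mem_iInter, mem_compl_iff]
    constructor
    · intro h0 n hn
      have h := le_of_mem_closure_quadrant hf Nat.one_div_pos_of_nat hn
      exact (h.trans_eq h0).not_gt Nat.one_div_pos_of_nat
    · intro h
      by_contra h0
      have hpos : 0 < f p := (hf0 p).lt_of_ne' h0
      obtain ⟨ε, hε, hball⟩ := Metric.mem_nhdsWithin_iff.1
        ((hf p).eventually (lt_mem_nhds (half_lt_self hpos)))
      obtain ⟨n, hn⟩ := exists_nat_one_div_lt (lt_min hε (half_pos hpos))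
      refine h n (subset_closure fun q hpq hq => ?_)
      exact (hn.le.trans (min_le_right _ _)).trans
        (le_of_lt (hball ⟨hq.trans (hn.trans_le (min_le_left _ _)), hpq⟩))
  rw [hU]
  exact .iInter fun n => isClosed_closure.isOpen_compl.isGδ

theorem FunctionallyClosedIn.completelySeparatedIn {X : Type*} {t : TopologicalSpace X}
    {A B : Set X} (hA : FunctionallyClosedIn t A) (hB : FunctionallyClosedIn t B)
    (hAB : Disjoint A B) : CompletelySeparatedIn t A B := by
  obtain ⟨f, hf, hfI, rfl⟩ := hA
  obtain ⟨g, hg, hgI, rfl⟩ := hB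
  have hpos : ∀ x, 0 < f x + g x := fun x => by
    refine (add_nonneg (hfI x).1 (hgI x).1).lt_of_ne' fun h => ?_
    have hfx : f x = 0 := by linarith [(hfI x).1, (hgI x).1]
    have hgx : g x = 0 := by linarith
    exact disjoint_left.1 hAB hfx hgx
  refine ⟨fun x => f x / (f x + g x), hf.div (hf.add hg) fun x => (hpos x).ne', fun x => ?_,
    fun x hx => ?_, fun x hx => ?_⟩
  · exact ⟨div_nonneg (hfI x).1 (hpos x).le,
      (div_le_one (hpos x)).2 (le_add_of_nonneg_right (hgI x).1)⟩
  · simp [show f x = 0 from hx]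
  · have h := hpos x
    beta_reduce
    rw [show g x = 0 from hx, add_zero] at h ⊢
    exact div_self h.ne'

theorem IsClosed.functionallyClosedIn_sorgPlane {F : Set (ℝ × ℝ)} (hF : IsClosed F) :
    FunctionallyClosedIn sorgPlane F := by
  rcases F.eq_empty_or_nonempty with rfl | hne
  · exact ⟨fun _ => 1, (continuous_const (y := (1 : ℝ))).continuous_sorgPlane, by simp, by simp⟩
  · refine ⟨fun p => min (Metric.infDist p F) 1,
      ((Metric.continuous_infDist_pt F).min continuous_const).continuous_sorgPlane,
      fun p => ⟨le_min Metric.infDist_nonneg zero_le_one, min_le_right _ _⟩, ?_⟩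
    ext p
    rw [hF.mem_iff_infDist_zero hne, mem_preimage, mem_singleton_iff]
    constructor
    · intro h
      simp [h]
    · intro h
      rcases min_choice (Metric.infDist p F) 1 with h' | h' <;> linarith

theorem FunctionallyClosedIn.iInter {X : Type*} {t : TopologicalSpace X} {A : ℕ → Set X}
    (hA : ∀ n, FunctionallyClosedIn t (A n)) : FunctionallyClosedIn t (⋂ n, A n) := by
  choose f hf hfI hfA using hA
  have hsum : Summable fun n : ℕ => (1 / 2 : ℝ) / 2 ^ n := summable_geometric_two' 1
  have hnonneg : ∀ x n, 0 ≤ 1 / 2 / 2 ^ n * f n x := fun x n =>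
    mul_nonneg (by positivity) (hfI n x).1
  have hle : ∀ x n, 1 / 2 / 2 ^ n * f n x ≤ 1 / 2 / 2 ^ n := fun x n =>
    mul_le_of_le_one_right (by positivity) (hfI n x).2
  have hs : ∀ x, Summable fun n => 1 / 2 / 2 ^ n * f n x := fun x =>
    .of_nonneg_of_le (hnonneg x) (hle x) hsum
  refine ⟨fun x => ∑' n, 1 / 2 / 2 ^ n * f n x,
    continuous_tsum (fun n => continuous_const.mul (hf n)) hsum fun n x => ?_,
    fun x => ⟨tsum_nonneg (hnonneg x), ?_⟩, ?_⟩
  · rw [Real.norm_of_nonneg (hnonneg x n)]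
    exact hle x n
  · exact ((hs x).tsum_le_tsum (hle x) hsum).trans_eq (tsum_geometric_two' 1)
  · ext x
    rw [mem_iInter, mem_preimage, mem_singleton_iff, ← (hs x).hasSum_iff,
      hasSum_zero_iff_of_nonneg (hnonneg x), funext_iff]
    refine forall_congr' fun n => ?_
    simp [hfA n]

/-- A set whose complement is covered by countably many sets, each completely separated
from it, is functionally closed. -/
theorem functionallyClosedIn_of_completelySeparatedIn {X : Type*} {t : TopologicalSpace X}
    {E : Set X} {F : ℕ → Set X} (hF : ∀ n, CompletelySeparatedIn t (F n) E)
    (hE : E = ⋂ n, (F n)ᶜ) : FunctionallyClosedIn t E := by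
  choose f hf hfI hfF hfE using hF
  have hEf : E = ⋂ n, (fun x => 1 - f n x) ⁻¹' {0} := by
    ext x
    simp only [mem_iInter, mem_preimage, mem_singleton_iff]
    constructor
    · intro hx n
      rw [hfE n x hx, sub_self]
    · intro h
      rw [hE, mem_iInter]
      intro n hn
      have := h n
      rw [hfF n x hn] at this
      norm_num at this
  rw [hEf]
  exact .iInter fun n => ⟨fun x => 1 - f n x, continuous_const.sub (hf n),
    fun x => ⟨sub_nonneg.2 (hfI n x).2, sub_le_self _ (hfI n x).1⟩, rfl⟩

/-- A set is functionally closed in the Sorgenfrey plane iff it is Euclidean-Gδ and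
completely separated (in 𝕊²) from every Euclidean-closed set disjoint from it. -/
theorem functionallyClosedIn_sorgPlane_iff (E : Set (ℝ × ℝ)) :
    FunctionallyClosedIn sorgPlane E ↔
      IsGδ E ∧
        ∀ F : Set (ℝ × ℝ), IsClosed F → Disjoint F E →
          CompletelySeparatedIn sorgPlane F E := by
  constructor
  · intro hE
    refine ⟨?_, fun F hF hFE => hF.functionallyClosedIn_sorgPlane.completelySeparatedIn hE hFE⟩
    obtain ⟨f, hf, hfI, rfl⟩ := hE
    exact isGδ_preimage_zero_of_continuous_sorgPlane hf fun p => (hfI p).1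
  · rintro ⟨hG, hsep⟩
    obtain ⟨U, hU, hEU⟩ := isGδ_iff_eq_iInter_nat.1 hG
    refine functionallyClosedIn_of_completelySeparatedIn (F := fun n => (U n)ᶜ)
      (fun n => hsep _ (hU n).isClosed_compl ?_) (by simpa using hEU)
    exact disjoint_compl_left_iff_subset.2 (hEU ▸ iInter_subset U n)
end

section
/- Let X be a metrizable space, let A ⊆ X be a nonempty set without isolated points (i.e., every point of A is an accumulation point of A in the subspace topology of A), and let B ⊆ X be a countable set with A ∩ B = ∅. Then there exists a nonempty set C ⊆ A without isolated points such that the closure of C in X is disjoint from B. -/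
open Topology Set

/-- Given a selection `f` of nearby points, there is an increasing sequence of sets `S n`,
each obtained from the previous one by adding the points `f x (δ n)`, where the scales `δ n` at
least halve at every step and are small compared to the distance from `b n` to `S (n + 1)`. -/
lemma exists_seq_of_selection {X : Type*} [MetricSpace X] {A : Set X} {f : X → ℝ → X}
    (hf : ∀ a ∈ A, ∀ ε > 0, f a ε ∈ A) {a : X} (ha : a ∈ A) {b : ℕ → X} (hb : ∀ n, b n ∉ A) :
    ∃ (S : ℕ → Set X) (δ : ℕ → ℝ), a ∈ S 0 ∧
      (∀ n, S (n + 1) = S n ∪ (fun x => f x (δ n)) '' S n) ∧ (∀ n, S n ⊆ A) ∧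
      (∀ n, 0 < δ n) ∧ (∀ n, δ (n + 1) ≤ δ n / 2) ∧
      ∀ n, ∀ x ∈ S (n + 1), 4 * δ (n + 1) ≤ dist (b n) x := by
  let grow : Set X × ℝ → Set X := fun p => p.1 ∪ (fun x => f x p.2) '' p.1
  let state : ℕ → Set X × ℝ := fun n => Nat.rec ({a}, 1)
    (fun k p => (grow p, min (p.2 / 2) (Metric.infDist (b k) (grow p) / 4))) n
  have hstate : ∀ n, (state n).1.Finite ∧ (state n).1.Nonempty ∧ (state n).1 ⊆ A ∧
      0 < (state n).2 := by
    intro n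
    induction n with
    | zero => exact ⟨finite_singleton a, singleton_nonempty a, singleton_subset_iff.2 ha, one_pos⟩
    | succ n ih =>
      obtain ⟨hfin, hne, hsub, hpos⟩ := ih
      have hfin' : (grow (state n)).Finite := hfin.union (hfin.image _)
      have hne' : (grow (state n)).Nonempty := hne.mono subset_union_left
      have hsub' : grow (state n) ⊆ A := by
        rintro x (hx | ⟨y, hy, rfl⟩)
        · exact hsub hx
        · exact hf y (hsub hy) _ hpos
      have hdist : 0 < Metric.infDist (b n) (grow (state n)) :=
        (hfin'.isClosed.notMem_iff_infDist_pos hne').1 fun h => hb n (hsub' h)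
      exact ⟨hfin', hne', hsub', lt_min (by linarith) (by linarith)⟩
  refine ⟨fun n => (state n).1, fun n => (state n).2, rfl, fun n => rfl,
    fun n => (hstate n).2.2.1, fun n => (hstate n).2.2.2, fun n => min_le_left _ _, ?_⟩
  intro n x hx
  have hmin : (state (n + 1)).2 ≤ Metric.infDist (b n) (state (n + 1)).1 / 4 := min_le_right _ _
  have hle := Metric.infDist_le_dist_of_mem (x := b n) hx
  dsimp only
  linarith

/-- In a metrizable space, given a nonempty set `A` without isolated points and a countable
set `B` disjoint from `A`, there is a nonempty `C ⊆ A` without isolated points whose closure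
is disjoint from `B`. -/
theorem exists_subset_no_isolated_points_closure_disjoint
    {X : Type*} [TopologicalSpace X] [TopologicalSpace.MetrizableSpace X]
    {A B : Set X} (hA : A.Nonempty) (hA' : ∀ a ∈ A, a ∈ closure (A \ {a}))
    (hB : B.Countable) (hAB : A ∩ B = ∅) :
    ∃ C : Set X, C ⊆ A ∧ C.Nonempty ∧ (∀ c ∈ C, c ∈ closure (C \ {c})) ∧
      closure C ∩ B = ∅ := by
  let := TopologicalSpace.metrizableSpaceMetric X
  rcases B.eq_empty_or_nonempty with rfl | hBne
  · exact ⟨A, Subset.rfl, hA, hA', inter_empty _⟩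
  obtain ⟨b, rfl⟩ := hB.exists_eq_range hBne
  have hb : ∀ n, b n ∉ A := fun n h => (hAB.subset ⟨h, mem_range_self n⟩ : b n ∈ (∅ : Set X))
  have hnear : ∀ (x : X) (ε : ℝ), ∃ y, x ∈ A → 0 < ε → y ∈ A ∧ y ≠ x ∧ dist x y < ε := by
    intro x ε
    by_cases h : x ∈ A ∧ 0 < ε
    · obtain ⟨y, hy, hxy⟩ := Metric.mem_closure_iff.1 (hA' x h.1) ε h.2
      exact ⟨y, fun _ _ => ⟨hy.1, hy.2, hxy⟩⟩
    · exact ⟨x, fun h₁ h₂ => absurd ⟨h₁, h₂⟩ h⟩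
  choose f hf using hnear
  obtain ⟨a, ha⟩ := hA
  obtain ⟨S, δ, haS, hS, hSA, hδ, hhalf, hdist⟩ :=
    exists_seq_of_selection (fun x hx ε hε => (hf x ε hx hε).1) ha hb
  have hmono : Monotone S := monotone_nat_of_le_succ fun n => by
    rw [hS n]; exact subset_union_left
  have hclose : ∀ n m, n ≤ m → ∀ x ∈ S m, ∃ y ∈ S n, dist x y ≤ 2 * (δ n - δ m) := by
    intro n m hnm
    induction m, hnm using Nat.le_induction with
    | base => exact fun x hx => ⟨x, hx, by simp⟩
    | succ m _ ih =>
      intro x hx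
      rw [hS m] at hx
      have hm := hhalf m
      have hm' := hδ m
      rcases hx with hx | ⟨z, hz, rfl⟩
      · obtain ⟨y, hy, hxy⟩ := ih x hx
        exact ⟨y, hy, by linarith⟩
      · obtain ⟨y, hy, hzy⟩ := ih z hz
        have hlt := (hf z (δ m) (hSA m hz) hm').2.2
        have htri := dist_triangle_left (f z (δ m)) y z
        exact ⟨y, hy, by dsimp only; linarith⟩
  have hpow : ∀ n, δ n ≤ δ 0 * (1 / 2) ^ n := by
    intro n
    induction n with
    | zero => simp
    | succ n ih => rw [pow_succ]; linarith [hhalf n]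
  have hsmall : Filter.Tendsto δ Filter.atTop (𝓝 0) := by
    refine squeeze_zero (fun n => (hδ n).le) hpow ?_
    simpa using (tendsto_pow_atTop_nhds_zero_of_lt_one (by norm_num : (0 : ℝ) ≤ 1 / 2)
      (by norm_num)).const_mul (δ 0)
  refine ⟨⋃ n, S n, iUnion_subset hSA, ⟨a, mem_iUnion.2 ⟨0, haS⟩⟩, ?_, ?_⟩
  · intro c hc
    obtain ⟨m, hm⟩ := mem_iUnion.1 hc
    refine Metric.mem_closure_iff.2 fun ε hε => ?_
    obtain ⟨n, hn, hmn⟩ :=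
      ((hsmall.eventually_lt_const hε).and (Filter.eventually_ge_atTop m)).exists
    have hcn : c ∈ S n := hmono hmn hm
    obtain ⟨-, hne, hlt⟩ := hf c (δ n) (hSA n hcn) (hδ n)
    refine ⟨f c (δ n), ⟨mem_iUnion.2 ⟨n + 1, ?_⟩, hne⟩, hlt.trans hn⟩
    rw [hS n]
    exact Or.inr ⟨c, hcn, rfl⟩
  · rw [eq_empty_iff_forall_notMem]
    rintro _ ⟨hx, n, rfl⟩
    obtain ⟨x, hxC, hbx⟩ := Metric.mem_closure_iff.1 hx (2 * δ (n + 1)) (by linarith [hδ (n + 1)])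
    obtain ⟨m, hm⟩ := mem_iUnion.1 hxC
    obtain ⟨y, hy, hxy⟩ := hclose (n + 1) (max m (n + 1)) (le_max_right _ _) x
      (hmono (le_max_left _ _) hm)
    linarith [hdist n y hy, dist_triangle (b n) x y, hδ (max m (n + 1))]
end

section
/- Let X be a separable metrizable space and let A ⊆ X be an uncountable set. Then there exists a set Q ⊆ A such that Q, with the subspace topology, is homeomorphic to the space ℚ of rational numbers (with its usual topology). -/
open Topology Set

/-- In a countable metric space every point has arbitrarily small clopen neighbourhoods. -/
theorem exists_isClopen_subset_ball_of_countable {D : Type*} [MetricSpace D] [Countable D] (p : D)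
    {ε : ℝ} (hε : 0 < ε) : ∃ V : Set D, IsClopen V ∧ p ∈ V ∧ V ⊆ Metric.ball p ε := by
  have hne : ¬ Ioo 0 ε ⊆ range fun q : D => dist q p := fun h =>
    (Cardinal.Real.Ioo_countable_iff.mp ((countable_range _).mono h)).not_gt hε
  obtain ⟨r, ⟨hr0, hrε⟩, hr⟩ := not_subset.mp hne
  have hball : Metric.ball p r = Metric.closedBall p r := by
    rw [← Metric.ball_union_sphere, eq_comm, union_eq_left]
    exact fun q hq => absurd ⟨q, hq⟩ hr
  refine ⟨Metric.ball p r, ⟨?_, Metric.isOpen_ball⟩, Metric.mem_ball_self hr0,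
    Metric.ball_subset_ball hrε.le⟩
  rw [hball]
  exact Metric.isClosed_closedBall

/-- A clopen set together with its first point with respect to the given encoding. -/
structure PointedClopen (D : Type*) [TopologicalSpace D] [Encodable D] where
  /-- The underlying clopen set. -/
  carrier : Set D
  /-- The distinguished point. -/
  pt : D
  isClopen : IsClopen carrier
  pt_mem : pt ∈ carrier
  encode_pt_le : ∀ x ∈ carrier, Encodable.encode pt ≤ Encodable.encode x

namespace PointedClopen

section Topological

variable {D : Type*} [TopologicalSpace D] [Encodable D]

theorem exists_carrier_eq {U : Set D} (hU : IsClopen U) (hne : U.Nonempty) :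
    ∃ s : PointedClopen D, s.carrier = U := by
  obtain ⟨p, hp, hmin⟩ := (measure (Encodable.encode : D → ℕ)).wf.has_min U hne
  exact ⟨⟨U, p, hU, hp, fun x hx => not_lt.mp (hmin x hx)⟩, rfl⟩

variable (D) in
/-- The whole space, with its first point. -/
noncomputable def root [Nonempty D] : PointedClopen D :=
  (exists_carrier_eq (isClopen_univ (X := D)) univ_nonempty).choose

theorem mem_root [Nonempty D] (x : D) : x ∈ (root D).carrier := by
  rw [root, (exists_carrier_eq (isClopen_univ (X := D)) univ_nonempty).choose_spec]
  trivial

end Topological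

variable {D : Type*} [MetricSpace D] [Encodable D]

theorem exists_split [PerfectSpace D] (s : PointedClopen D) (n : ℕ) :
    ∃ c : Bool → PointedClopen D, (c false).pt = s.pt ∧
      (c false).carrier ⊆ Metric.ball s.pt (1 / (n + 1)) ∧
      (c true).carrier = s.carrier \ (c false).carrier ∧ (c false).carrier ⊆ s.carrier := by
  obtain ⟨q, ⟨hqU, -⟩, hqp⟩ := preperfect_iff_nhds.mp PerfectSpace.univ_preperfect s.pt
    (mem_univ _) _ (s.isClopen.isOpen.mem_nhds s.pt_mem)
  obtain ⟨V, hV, hpV, hVball⟩ := exists_isClopen_subset_ball_of_countable s.pt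
    (ε := min (1 / (n + 1)) (dist q s.pt)) (lt_min (by positivity) (dist_pos.mpr hqp))
  have hqV : q ∉ V := fun h =>
    (lt_of_lt_of_le (Metric.mem_ball.mp (hVball h)) (min_le_right _ _)).false
  obtain ⟨t, ht⟩ :=
    exists_carrier_eq (s.isClopen.diff (s.isClopen.inter hV)) ⟨q, hqU, fun h => hqV h.2⟩
  exact ⟨fun b => bif b then t else
      ⟨s.carrier ∩ V, s.pt, s.isClopen.inter hV, ⟨s.pt_mem, hpV⟩,
        fun x hx => s.encode_pt_le x hx.1⟩,
    rfl, fun x hx => Metric.ball_subset_ball (min_le_left _ _) (hVball hx.2), ht, inter_subset_left⟩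

variable [PerfectSpace D]

/-- The two halves of a pointed clopen set: `false` is a small neighbourhood of the distinguished
point, `true` is the rest. -/
noncomputable def child (s : PointedClopen D) (n : ℕ) : Bool → PointedClopen D :=
  (exists_split s n).choose

theorem child_false_pt (s : PointedClopen D) (n : ℕ) : (s.child n false).pt = s.pt :=
  (exists_split s n).choose_spec.1

theorem child_false_subset_ball (s : PointedClopen D) (n : ℕ) :
    (s.child n false).carrier ⊆ Metric.ball s.pt (1 / (n + 1)) :=
  (exists_split s n).choose_spec.2.1

theorem mem_child_iff (s : PointedClopen D) (n : ℕ) (b : Bool) (x : D) :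
    x ∈ (s.child n b).carrier ↔
      x ∈ s.carrier ∧ (b = true ↔ x ∉ (s.child n false).carrier) := by
  obtain ⟨-, -, h, h'⟩ := (exists_split s n).choose_spec
  cases b
  · have : (s.child n false).carrier ⊆ s.carrier := h'
    simpa using fun hx => this hx
  · have : (s.child n true).carrier = s.carrier \ (s.child n false).carrier := h
    simp [this]

theorem encode_pt_lt_child_true (s : PointedClopen D) (n : ℕ) :
    Encodable.encode s.pt < Encodable.encode (s.child n true).pt := by
  have h := (mem_child_iff s n true _).mp (s.child n true).pt_mem
  refine (s.encode_pt_le _ h.1).lt_of_ne fun heq => h.2.mp rfl ?_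
  rw [← Encodable.encode_injective heq, ← child_false_pt s n]
  exact (s.child n false).pt_mem

theorem encode_pt_le_child (s : PointedClopen D) (n : ℕ) (b : Bool) :
    Encodable.encode s.pt ≤ Encodable.encode (s.child n b).pt := by
  cases b
  · rw [child_false_pt]
  · exact (encode_pt_lt_child_true s n).le

variable [Nonempty D]

/-- The vertices along a branch of the binary tree of iterated splittings. -/
noncomputable def node (a : ℕ → Bool) : ℕ → PointedClopen D
  | 0 => root D
  | n + 1 => (node a n).child n (a n)

open Classical in
/-- The vertices whose carrier contains a given point. -/
noncomputable def path (x : D) : ℕ → PointedClopen D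
  | 0 => root D
  | n + 1 => (path x n).child n (decide (x ∉ ((path x n).child n false).carrier))

open Classical in
/-- The branch of the binary tree determined by a point. -/
noncomputable def code (x : D) (n : ℕ) : Bool :=
  decide (x ∉ ((path x n).child n false).carrier)

theorem path_eq_node_code (x : D) (n : ℕ) : path x n = node (code x) n := by
  induction n with
  | zero => rfl
  | succ n ih => rw [node, ← ih]; rfl

theorem code_eq_true_iff (x : D) (n : ℕ) :
    code x n = true ↔ x ∉ ((node (code x) n).child n false).carrier := by
  simp [← path_eq_node_code, code]

theorem node_congr {a b : ℕ → Bool} {n : ℕ} (h : ∀ i < n, a i = b i) :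
    (node a n : PointedClopen D) = node b n := by
  induction n with
  | zero => rfl
  | succ n ih => rw [node, node, ih fun i hi => h i (hi.trans n.lt_succ_self), h n n.lt_succ_self]

theorem mem_node_code (x : D) (n : ℕ) : x ∈ (node (code x) n).carrier := by
  induction n with
  | zero => exact mem_root x
  | succ n ih =>
    rw [node, mem_child_iff]
    exact ⟨ih, code_eq_true_iff x n⟩

theorem mem_node_iff (x : D) (a : ℕ → Bool) (n : ℕ) :
    x ∈ (node a n).carrier ↔ ∀ i < n, code x i = a i := by
  refine ⟨fun hx => ?_, fun h => node_congr (D := D) h ▸ mem_node_code x n⟩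
  induction n with
  | zero => simp
  | succ n ih =>
    rw [node, mem_child_iff] at hx
    have h := ih hx.1
    refine Nat.forall_lt_succ_right.mpr ⟨h, ?_⟩
    rw [Bool.eq_iff_iff, hx.2, code_eq_true_iff, node_congr h]

theorem node_pt_eq {a : ℕ → Bool} {N : ℕ} (h : ∀ n ≥ N, a n = false) {n : ℕ} (hn : N ≤ n) :
    (node a n : PointedClopen D).pt = (node a N).pt := by
  induction n, hn using Nat.le_induction with
  | base => rfl
  | succ n hn ih => rw [node, h n hn, child_false_pt, ih]

theorem code_eventually_false (x : D) : ∃ N, ∀ n ≥ N, code x n = false := by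
  have hmono : Monotone fun n => Encodable.encode (node (D := D) (code x) n).pt :=
    monotone_nat_of_le_succ fun n => encode_pt_le_child _ _ _
  obtain ⟨N, hN⟩ : ∃ N, ∀ n ≥ N,
      Encodable.encode (node (D := D) (code x) n).pt =
        Encodable.encode (node (D := D) (code x) N).pt := by
    have hfin : (range fun n => Encodable.encode (node (D := D) (code x) n).pt).Finite :=
      (finite_Iic (Encodable.encode x)).subset <| by
        rintro _ ⟨n, rfl⟩
        exact (node (code x) n).encode_pt_le x (mem_node_code x n)
    obtain ⟨_, ⟨N, rfl⟩, hN⟩ := exists_max_image _ id hfin (range_nonempty _)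
    exact ⟨N, fun n hn => (hN _ (mem_range_self n)).antisymm (hmono hn)⟩
  refine ⟨N, fun n hn => Bool.eq_false_iff.mpr fun hc => ?_⟩
  have hlt := encode_pt_lt_child_true (node (D := D) (code x) n) n
  have hsucc := hN (n + 1) (hn.trans n.le_succ)
  rw [node, hc] at hsucc
  rw [hN n hn, hsucc] at hlt
  exact hlt.false

theorem node_code_subset_ball {x : D} {N : ℕ} (h : ∀ n ≥ N, code x n = false) {n : ℕ}
    (hn : N ≤ n) : (node (code x) (n + 1)).carrier ⊆
      Metric.ball (node (D := D) (code x) N).pt (1 / (n + 1)) := by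
  rw [node, h n hn, ← node_pt_eq h hn]
  exact child_false_subset_ball _ _

theorem node_code_pt_eq {x : D} {N : ℕ} (h : ∀ n ≥ N, code x n = false) :
    (node (code x) N).pt = x := by
  refine (eq_of_forall_dist_le fun ε hε => ?_).symm
  obtain ⟨m, hm⟩ := exists_nat_one_div_lt hε
  have hle : (1 : ℝ) / ((max N m : ℕ) + 1) ≤ 1 / (m + 1) :=
    Nat.one_div_le_one_div (le_max_right N m)
  have hx : dist x _ < _ := node_code_subset_ball h (le_max_left N m) (mem_node_code x _)
  exact (hx.trans_le (hle.trans hm.le)).le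

theorem exists_node_code_subset (x : D) {W : Set D} (hW : W ∈ 𝓝 x) :
    ∃ n, (node (code x) n).carrier ⊆ W := by
  obtain ⟨N, hN⟩ := code_eventually_false x
  obtain ⟨ε, hε, hεW⟩ := Metric.mem_nhds_iff.mp hW
  obtain ⟨m, hm⟩ := exists_nat_one_div_lt hε
  have hle : (1 : ℝ) / ((max N m : ℕ) + 1) ≤ 1 / (m + 1) :=
    Nat.one_div_le_one_div (le_max_right N m)
  have hsub := node_code_subset_ball hN (le_max_left N m)
  rw [node_code_pt_eq hN] at hsub
  exact ⟨_, hsub.trans ((Metric.ball_subset_ball (hle.trans hm.le)).trans hεW)⟩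

theorem continuous_code : Continuous (code : D → ℕ → Bool) := by
  refine continuous_pi fun n => continuous_iff_continuousAt.mpr fun x => ?_
  refine continuousAt_const.congr (g := fun y => code y n) (f := fun _ => code x n) ?_
  filter_upwards [(node (code x) (n + 1)).isClopen.isOpen.mem_nhds (mem_node_code x _)] with y hy
  exact ((mem_node_iff y _ _).mp hy n n.lt_succ_self).symm

theorem isEmbedding_code : IsEmbedding (code : D → ℕ → Bool) := by
  refine IsInducing.isEmbedding (isInducing_iff_nhds.mpr fun x => ?_)
  refine le_antisymm (continuous_code.tendsto x).le_comap fun W hW => ?_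
  obtain ⟨n, hn⟩ := exists_node_code_subset x hW
  refine ⟨PiNat.cylinder (code x) n,
    (PiNat.isOpen_cylinder _ _ _).mem_nhds (PiNat.self_mem_cylinder _ _), fun y hy => hn ?_⟩
  exact (mem_node_iff y _ _).mpr (PiNat.mem_cylinder_iff.mp hy)

theorem range_code : range (code : D → ℕ → Bool) = {a | ∃ N, ∀ n ≥ N, a n = false} := by
  ext a
  constructor
  · rintro ⟨x, rfl⟩
    exact code_eventually_false x
  · rintro ⟨N, hN⟩
    refine ⟨(node a N).pt, funext fun i => ?_⟩
    have hmem := (node (D := D) a (max N (i + 1))).pt_mem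
    rw [node_pt_eq hN (le_max_left _ _)] at hmem
    exact (mem_node_iff _ _ _).mp hmem i (i.lt_succ_self.trans_le (le_max_right _ _))

end PointedClopen

/-- **Sierpiński's theorem**: any two nonempty countable metrizable spaces without isolated points
are homeomorphic. -/
theorem nonempty_homeomorph_of_countable_perfectSpace (D E : Type*)
    [TopologicalSpace D] [TopologicalSpace.MetrizableSpace D] [Countable D] [PerfectSpace D]
    [Nonempty D] [TopologicalSpace E] [TopologicalSpace.MetrizableSpace E] [Countable E]
    [PerfectSpace E] [Nonempty E] : Nonempty (D ≃ₜ E) := by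
  let := TopologicalSpace.metrizableSpaceMetric D
  let := TopologicalSpace.metrizableSpaceMetric E
  let := Encodable.ofCountable D
  let := Encodable.ofCountable E
  have hrange : range (PointedClopen.code : D → ℕ → Bool) =
      range (PointedClopen.code : E → ℕ → Bool) := by
    rw [PointedClopen.range_code, PointedClopen.range_code]
  exact ⟨PointedClopen.isEmbedding_code.toHomeomorph.trans
    ((Homeomorph.setCongr hrange).trans PointedClopen.isEmbedding_code.toHomeomorph.symm)⟩

theorem Preperfect.perfectSpace_subtype {α : Type*} [TopologicalSpace α] {C : Set α}
    (hC : Preperfect C) : PerfectSpace C := by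
  refine ⟨preperfect_iff_nhds.mpr fun x _ U hU => ?_⟩
  obtain ⟨V, hV, hVU⟩ := mem_nhds_subtype C x U |>.mp hU
  obtain ⟨y, ⟨hyV, hyC⟩, hyx⟩ := preperfect_iff_nhds.mp hC x x.2 V hV
  exact ⟨⟨y, hyC⟩, ⟨hVU hyV, trivial⟩, fun h => hyx (congrArg Subtype.val h)⟩

/-- Every uncountable subset of a separable metrizable space contains a subset
homeomorphic to the rationals. -/
theorem exists_subset_homeomorphic_rat
    {X : Type*} [TopologicalSpace X] [TopologicalSpace.MetrizableSpace X]
    [TopologicalSpace.SeparableSpace X] {A : Set X} (hA : ¬ A.Countable) :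
    ∃ Q : Set X, Q ⊆ A ∧ Nonempty (Q ≃ₜ ℚ) := by
  let := TopologicalSpace.metrizableSpaceMetric X
  have := UniformSpace.secondCountable_of_separable X
  obtain ⟨P, hP, hPne, -⟩ := exists_perfect_nonempty_of_isClosed_of_not_countable
    (isClosed_univ (X := A)) (by rwa [countable_univ_iff, countable_coe_iff])
  obtain ⟨D, hDP, hDc, hPD⟩ :=
    (TopologicalSpace.IsSeparable.of_separableSpace P).exists_countable_dense_subset
  have hclosure : closure D = P := (hP.closed.closure_subset_iff.mpr hDP).antisymm hPD
  have : PerfectSpace D :=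
    (preperfect_iff_perfect_closure.mpr (hclosure ▸ hP)).perfectSpace_subtype
  have : Nonempty D := (closure_nonempty_iff.mp (hclosure ▸ hPne)).to_subtype
  have : Countable D := hDc.to_subtype
  obtain ⟨f⟩ := nonempty_homeomorph_of_countable_perfectSpace D ℚ
  exact ⟨Subtype.val '' D, Subtype.coe_image_subset A D,
    ⟨(IsEmbedding.subtypeVal.homeomorphImage D).symm.trans f⟩⟩
end

section
/- Let A ⊆ ℝ² be closed in the Sorgenfrey plane 𝕊² and let ε > 0. Then the set L(A; ε) = { p = (x, y) ∈ ℝ² : [x, x+ε) × [y, y+ε) ⊆ A } is closed in the Euclidean topology of ℝ². -/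
open Topology Set

/-- Euclidean right neighbourhoods refine Sorgenfrey neighbourhoods. -/
theorem nhdsGT_le_nhds_sorgTop (x : ℝ) : 𝓝[>] x ≤ @nhds ℝ sorgTop x := by
  suffices h : Filter.Tendsto id (𝓝[>] x) (@nhds ℝ sorgTop x) by
    simpa only [Filter.Tendsto, Filter.map_id] using h
  refine TopologicalSpace.tendsto_nhds_generateFrom_iff.2 ?_
  rintro s ⟨a, b, rfl⟩ hx
  filter_upwards [Ioo_mem_nhdsGT hx.2] with y hy
  exact ⟨hx.1.trans hy.1.le, hy.2⟩

theorem nhdsGT_prod_le_nhds_sorgPlane (q : ℝ × ℝ) :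
    𝓝[>] q.1 ×ˢ 𝓝[>] q.2 ≤ @nhds (ℝ × ℝ) sorgPlane q := by
  have h := @nhds_prod_eq ℝ ℝ sorgTop sorgTop q.1 q.2
  exact (Filter.prod_mono (nhdsGT_le_nhds_sorgTop q.1)
    (nhdsGT_le_nhds_sorgTop q.2)).trans_eq h.symm

/-- If `A` is closed in the Sorgenfrey plane and `ε > 0`, the set of points `p` whose
half-open square `B[p; ε)` lies inside `A` is closed in the Euclidean topology. -/
theorem lower_set_of_sorgenfrey_closed_isClosed (A : Set (ℝ × ℝ))
    (hA : IsClosed[sorgPlane] A) (ε : ℝ) (hε : 0 < ε) :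
    IsClosed {p : ℝ × ℝ | Set.Ico p.1 (p.1 + ε) ×ˢ Set.Ico p.2 (p.2 + ε) ⊆ A} := by
  rw [← isOpen_compl_iff, isOpen_iff_mem_nhds]
  intro p hp
  obtain ⟨q, ⟨hq₁, hq₂⟩, hqA⟩ := Set.not_subset.1 hp
  have hA' : ∀ᶠ r in 𝓝[>] q.1 ×ˢ 𝓝[>] q.2, r ∈ Aᶜ :=
    nhdsGT_prod_le_nhds_sorgPlane q
      (@IsOpen.mem_nhds _ sorgPlane q Aᶜ (@IsClosed.isOpen_compl _ sorgPlane A hA) hqA)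
  have hsq : ∀ᶠ r in 𝓝[>] q.1 ×ˢ 𝓝[>] q.2,
      r ∈ Ioo q.1 (p.1 + ε) ×ˢ Ioo q.2 (p.2 + ε) :=
    Filter.prod_mem_prod (Ioo_mem_nhdsGT hq₁.2) (Ioo_mem_nhdsGT hq₂.2)
  obtain ⟨r, hrA, hr₁, hr₂⟩ := (hA'.and hsq).exists
  have h₁ : Ioo (r.1 - ε) r.1 ∈ 𝓝 p.1 :=
    Ioo_mem_nhds (by linarith [hr₁.2]) (hq₁.1.trans_lt hr₁.1)
  have h₂ : Ioo (r.2 - ε) r.2 ∈ 𝓝 p.2 :=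
    Ioo_mem_nhds (by linarith [hr₂.2]) (hq₂.1.trans_lt hr₂.1)
  filter_upwards [prod_mem_nhds h₁ h₂] with p' hp' hsub
  obtain ⟨⟨ha, hb⟩, hc, hd⟩ := hp'
  exact hrA (hsub ⟨⟨hb.le, by linarith⟩, hd.le, by linarith⟩)
end

section
/- Let 𝔻 = {(x, −x) : x ∈ ℝ} be the anti-diagonal of the Sorgenfrey plane 𝕊². If E ⊆ 𝔻 is countable and is a Gδ-set in the Euclidean topology of ℝ², then E is functionally closed in 𝕊². -/
open Topology Set

lemma isOpen_sorgTop_of_forall_Ico_subset {s : Set ℝ}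
    (h : ∀ x ∈ s, ∃ b > x, Ico x b ⊆ s) : IsOpen[sorgTop] s := by
  refine (@isOpen_iff_forall_mem_open ℝ sorgTop s).2 fun x hx => ?_
  obtain ⟨b, hb, hs⟩ := h x hx
  exact ⟨Ico x b, hs, TopologicalSpace.isOpen_generateFrom_of_mem ⟨x, b, rfl⟩, le_rfl, hb⟩

lemma sorgTop_le : sorgTop ≤ UniformSpace.toTopologicalSpace := fun _ hs =>
  isOpen_sorgTop_of_forall_Ico_subset fun _ hx =>
    exists_Ico_subset_of_mem_nhds (IsOpen.mem_nhds hs hx) (exists_gt _)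

lemma sorgPlane_le : sorgPlane ≤ instTopologicalSpaceProd :=
  inf_le_inf (induced_mono sorgTop_le) (induced_mono sorgTop_le)

lemma isClopen_sorgTop_Ico (a b : ℝ) : @IsClopen ℝ sorgTop (Ico a b) := by
  refine ⟨@IsClosed.mk ℝ sorgTop _ (isOpen_sorgTop_of_forall_Ico_subset fun x hx => ?_),
    TopologicalSpace.isOpen_generateFrom_of_mem ⟨a, b, rfl⟩⟩
  by_cases hxa : x < a
  · exact ⟨a, hxa, fun y hy hy' => hy'.1.not_gt hy.2⟩
  · refine ⟨x + 1, by simp, fun y hy hy' => hx ⟨not_lt.1 hxa, hy.1.trans_lt hy'.2⟩⟩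

lemma isClopen_sorgPlane_Ico_prod_Ico (a b c d : ℝ) :
    @IsClopen (ℝ × ℝ) sorgPlane (Ico a b ×ˢ Ico c d) :=
  @IsClopen.prod ℝ ℝ sorgTop sorgTop _ _ (isClopen_sorgTop_Ico a b) (isClopen_sorgTop_Ico c d)

/-- A union of a sequence of clopen sets which is locally finite at every point outside
the union is clopen. -/
lemma isClopen_iUnion_of_locallyFinite_compl {X : Type*} [TopologicalSpace X] {S : ℕ → Set X}
    (hS : ∀ k, IsClopen (S k))
    (h : ∀ x ∉ ⋃ k, S k, ∃ N, IsOpen N ∧ x ∈ N ∧ ∃ K, ∀ k ≥ K, Disjoint (S k) N) :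
    IsClopen (⋃ k, S k) := by
  refine ⟨⟨isOpen_iff_forall_mem_open.2 fun x hx => ?_⟩, isOpen_iUnion fun k => (hS k).2⟩
  obtain ⟨N, hN, hxN, K, hK⟩ := h x hx
  refine ⟨N ∩ ⋂ k ∈ Finset.range K, (S k)ᶜ, ?_,
    hN.inter (isOpen_biInter_finset fun k _ => (hS k).1.isOpen_compl), hxN, ?_⟩
  · rintro y ⟨hyN, hy⟩ hyS
    obtain ⟨k, hk⟩ := mem_iUnion.1 hyS
    rcases lt_or_ge k K with hkK | hkK
    · exact mem_iInter₂.1 hy k (Finset.mem_range.2 hkK) hk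
    · exact disjoint_left.1 (hK k hkK) hk hyN
  · exact mem_iInter₂.2 fun k _ hk => hx (mem_iUnion.2 ⟨k, hk⟩)

lemma functionallyClosedIn_of_isClopen {X : Type*} [t : TopologicalSpace X] {U : Set X}
    (hU : IsClopen U) {g : X → ℝ} (hg : Continuous g) (h0 : ∀ x ∈ U, 0 ≤ g x) :
    FunctionallyClosedIn t {x ∈ U | g x = 0} := by
  classical
  refine ⟨U.piecewise (fun x => min 1 (g x)) fun _ => 1,
    (continuous_const.min hg).piecewise (by simp [hU.frontier_eq]) continuous_const, fun x => ?_, ?_⟩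
  · by_cases hx : x ∈ U <;> simp [hx, h0]
  · ext x
    by_cases hx : x ∈ U
    · simp only [mem_ofPred_eq, hx, true_and, mem_preimage, piecewise_eq_of_mem, mem_singleton_iff]
      rcases min_cases 1 (g x) with h | h <;> constructor <;> intro <;> linarith
    · simp [hx]

/-- The points of a sequence enumerating a `Gδ` set are centres of arbitrarily small intervals
that are point-finite outside that set. -/
lemma exists_radii_point_finite_compl {x : ℕ → ℝ} (hG : IsGδ (range x)) :
    ∃ r : ℕ → ℝ, (∀ k, 0 < r k ∧ r k ≤ 1 / (k + 1)) ∧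
      ∀ u ∉ range x, ∃ K, ∀ k ≥ K, r k ≤ |u - x k| := by
  obtain ⟨G, hGo, hG⟩ := hG.eq_iInter_nat
  have hr (k : ℕ) : ∃ r : ℝ, (0 < r ∧ r ≤ 1 / (k + 1)) ∧
      Metric.ball (x k) r ⊆ ⋂ j ∈ Finset.range (k + 1), G j := by
    have hopen : IsOpen (⋂ j ∈ Finset.range (k + 1), G j) :=
      isOpen_biInter_finset fun j _ => hGo j
    have hmem : x k ∈ ⋂ j ∈ Finset.range (k + 1), G j :=
      mem_iInter₂.2 fun j _ => mem_iInter.1 (hG ▸ mem_range_self k) j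
    obtain ⟨ε, hε, hεG⟩ := Metric.isOpen_iff.1 hopen _ hmem
    exact ⟨min ε (1 / (k + 1)), ⟨lt_min hε (by positivity), min_le_right _ _⟩,
      (Metric.ball_subset_ball (min_le_left _ _)).trans hεG⟩
  choose r hr hrG using hr
  refine ⟨r, hr, fun u hu => ?_⟩
  rw [hG, mem_iInter, not_forall] at hu
  obtain ⟨K, hK⟩ := hu
  refine ⟨K, fun k hk => le_of_not_gt fun hlt => hK ?_⟩
  exact mem_iInter₂.1 (hrG k (by rwa [Metric.mem_ball, Real.dist_eq])) K
    (Finset.mem_range.2 (by lia))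

lemma isClopen_sorgPlane_iUnion_squares {x r : ℕ → ℝ} (hr : ∀ k, r k ≤ 1 / (k + 1))
    (hfin : ∀ u ∉ range x, ∃ K, ∀ k ≥ K, r k ≤ |u - x k|) (hpos : ∀ k, 0 < r k) :
    @IsClopen (ℝ × ℝ) sorgPlane
      (⋃ k, Ico (x k) (x k + r k) ×ˢ Ico (-x k) (-x k + r k)) := by
  refine @isClopen_iUnion_of_locallyFinite_compl _ sorgPlane _
    (fun k => isClopen_sorgPlane_Ico_prod_Ico _ _ _ _) ?_
  rintro ⟨u, v⟩ hq
  rcases lt_trichotomy (u + v) 0 with h | h | h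
  · refine ⟨{p | p.1 + p.2 < 0},
      sorgPlane_le _ (isOpen_lt (by fun_prop) continuous_const), h, 0, fun k _ => ?_⟩
    rw [disjoint_left]
    rintro ⟨a, b⟩ ⟨⟨h1, -⟩, h2, -⟩ (h3 : a + b < 0)
    simp only at h1 h2
    linarith
  · obtain rfl : v = -u := by linarith
    have hu : u ∉ range x := by
      rintro ⟨k, rfl⟩
      exact hq (mem_iUnion.2 ⟨k, by simp [hpos k]⟩)
    obtain ⟨K, hK⟩ := hfin u hu
    refine ⟨Ico u (u + 1) ×ˢ Ico (-u) (-u + 1),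
      (isClopen_sorgPlane_Ico_prod_Ico _ _ _ _).2, by simp, K, fun k hk => ?_⟩
    rw [disjoint_left]
    rintro ⟨a, b⟩ ⟨⟨h1, h2⟩, h3, h4⟩ ⟨⟨h5, h6⟩, h7, h8⟩
    refine (hK k hk).not_gt (abs_lt.2 ⟨?_, ?_⟩) <;> simp only at * <;> linarith
  · obtain ⟨K, hK⟩ := exists_nat_one_div_lt (show 0 < (u + v) / 4 by linarith)
    refine ⟨{p | (u + v) / 2 < p.1 + p.2},
      sorgPlane_le _ (isOpen_lt continuous_const (by fun_prop)),
      show (u + v) / 2 < u + v by linarith, K, fun k hk => ?_⟩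
    rw [disjoint_left]
    rintro ⟨a, b⟩ ⟨⟨-, h1⟩, -, h2⟩ (h3 : (u + v) / 2 < a + b)
    have := (hr k).trans (Nat.one_div_le_one_div hk)
    simp only at h1 h2
    linarith

/-- A countable Euclidean-Gδ subset of the anti-diagonal is functionally closed
in the Sorgenfrey plane. -/
theorem antidiagonal_countable_Gdelta_functionallyClosed (E : Set (ℝ × ℝ))
    (hE : E ⊆ {p : ℝ × ℝ | p.2 = -p.1})
    (hc : E.Countable) (hG : IsGδ E) :
    FunctionallyClosedIn sorgPlane E := by
  rcases E.eq_empty_or_nonempty with rfl | hne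
  · exact ⟨fun _ => 1, @continuous_const _ _ sorgPlane _ _, by simp, by simp⟩
  obtain ⟨e, rfl⟩ := hc.exists_eq_range hne
  have he (k : ℕ) : (e k).2 = -(e k).1 := hE (mem_range_self k)
  have hpre : (fun x : ℝ => (x, -x)) ⁻¹' range e = range fun k => (e k).1 := by
    ext x
    simp only [mem_preimage, mem_range, Prod.ext_iff]
    exact exists_congr fun k => ⟨fun h => h.1, fun h => ⟨h, by rw [he, h]⟩⟩
  have hG' : IsGδ (range fun k => (e k).1) := by
    rw [← hpre]
    exact hG.preimage (by fun_prop)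
  obtain ⟨r, hr, hfin⟩ := exists_radii_point_finite_compl hG'
  have key := @functionallyClosedIn_of_isClopen _ sorgPlane _
    (isClopen_sorgPlane_iUnion_squares (fun k => (hr k).2) hfin fun k => (hr k).1)
    (fun p => p.1 + p.2) (continuous_le_dom sorgPlane_le (by fun_prop)) (by
      rintro ⟨a, b⟩ hp
      obtain ⟨k, ⟨h1, -⟩, h2, -⟩ := mem_iUnion.1 hp
      simp only at *
      linarith)
  convert key using 1
  ext ⟨a, b⟩
  constructor
  · rintro ⟨k, hk⟩
    have hab := he k
    rw [hk] at hab
    simp only at hab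
    refine ⟨mem_iUnion.2 ⟨k, ?_⟩, by simp [hab]⟩
    simp [hk, hab, (hr k).1]
  · rintro ⟨hp, hab⟩
    obtain ⟨k, ⟨h1, -⟩, h2, -⟩ := mem_iUnion.1 hp
    refine ⟨k, Prod.ext ?_ ?_⟩ <;> simp only [he] at * <;> linarith
end

section
/- Let D ⊆ 𝔻 = {(x, −x) : x ∈ ℝ} be a subset of the anti-diagonal that is closed in the Euclidean topology of ℝ². Then the set U = ⋃_{p ∈ D} B[p; 1), where for p = (x, y) the set B[p; 1) is [x, x+1) × [y, y+1), is clopen (both open and closed) in the Sorgenfrey plane 𝕊², and U ∩ 𝔻 = D. -/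
open Topology Set

/-- A product of two half-open intervals is open in the Sorgenfrey plane. -/
theorem isOpen_sorgPlane_Ico_prod_Ico (a b c d : ℝ) :
    IsOpen[sorgPlane] (Ico a b ×ˢ Ico c d) :=
  @IsOpen.prod ℝ ℝ sorgTop sorgTop _ _
    (TopologicalSpace.isOpen_generateFrom_of_mem ⟨a, b, rfl⟩)
    (TopologicalSpace.isOpen_generateFrom_of_mem ⟨c, d, rfl⟩)

/-- A set containing a half-open square at each of its points is Sorgenfrey open. -/
theorem isOpen_sorgPlane_of_forall_exists_square {s : Set (ℝ × ℝ)}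
    (h : ∀ p ∈ s, ∃ ε > 0, Ico p.1 (p.1 + ε) ×ˢ Ico p.2 (p.2 + ε) ⊆ s) :
    IsOpen[sorgPlane] s := by
  refine (@isOpen_iff_forall_mem_open (ℝ × ℝ) sorgPlane s).2 fun p hp => ?_
  obtain ⟨ε, hε, hs⟩ := h p hp
  exact ⟨_, hs, isOpen_sorgPlane_Ico_prod_Ico _ _ _ _, by simp [hε], by simp [hε]⟩

/-- A point outside a closed set of reals has an open interval around it missing the set. -/
theorem exists_pos_forall_mem_le_abs_sub {T : Set ℝ} (hT : IsClosed T) {x : ℝ} (hx : x ∉ T) :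
    ∃ ε > 0, ∀ t ∈ T, ε ≤ |t - x| := by
  obtain ⟨ε, hε, h⟩ := Metric.isOpen_iff.1 hT.isOpen_compl x hx
  refine ⟨ε, hε, fun t ht => ?_⟩
  by_contra! hlt
  exact h (by rwa [Metric.mem_ball, Real.dist_eq]) ht

/-- For a Euclidean-closed subset `D` of the anti-diagonal, the union of the half-open
unit squares `B[p; 1)`, `p ∈ D`, is clopen in the Sorgenfrey plane and meets the
anti-diagonal exactly in `D`. -/
theorem union_of_squares_clopen (D : Set (ℝ × ℝ))
    (hD : D ⊆ {p : ℝ × ℝ | p.2 = -p.1}) (hDc : IsClosed D)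
    (U : Set (ℝ × ℝ))
    (hU : U = ⋃ p ∈ D, Set.Ico p.1 (p.1 + 1) ×ˢ Set.Ico p.2 (p.2 + 1)) :
    IsOpen[sorgPlane] U ∧ IsClosed[sorgPlane] U ∧
      U ∩ {p : ℝ × ℝ | p.2 = -p.1} = D := by
  have hmem : ∀ x y, (x, y) ∈ U ↔
      ∃ t, (t, -t) ∈ D ∧ t ≤ x ∧ x < t + 1 ∧ -t ≤ y ∧ y < -t + 1 := by
    intro x y
    simp only [hU, mem_iUnion, mem_prod, mem_Ico, exists_prop]
    constructor
    · rintro ⟨⟨t, u⟩, hp, ⟨h1, h2⟩, h3, h4⟩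
      obtain rfl : u = -t := hD hp
      exact ⟨t, hp, h1, h2, h3, h4⟩
    · rintro ⟨t, hp, h1, h2, h3, h4⟩
      exact ⟨(t, -t), hp, ⟨h1, h2⟩, h3, h4⟩
  have hT : IsClosed {t : ℝ | (t, -t) ∈ D} :=
    hDc.preimage (f := fun t : ℝ => (t, -t)) (by fun_prop)
  refine ⟨?_, ?_, ?_⟩
  · rw [hU]
    exact @isOpen_biUnion _ _ sorgPlane _ _ fun p _ => isOpen_sorgPlane_Ico_prod_Ico _ _ _ _
  · refine (@isOpen_compl_iff _ _ sorgPlane).1 (isOpen_sorgPlane_of_forall_exists_square ?_)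
    rintro ⟨x, y⟩ hxy
    rw [mem_compl_iff, hmem] at hxy
    suffices h : ∃ ε > 0, ∀ x' y' t, x ≤ x' → x' < x + ε → y ≤ y' → y' < y + ε →
        (t, -t) ∈ D → t ≤ x' → x' < t + 1 → -t ≤ y' → y' < -t + 1 → False by
      obtain ⟨ε, hε, h⟩ := h
      refine ⟨ε, hε, ?_⟩
      rintro ⟨x', y'⟩ ⟨⟨hx, hx'⟩, hy, hy'⟩ hU'
      obtain ⟨t, ht, h1, h2, h3, h4⟩ := (hmem x' y').1 hU'
      exact h x' y' t hx hx' hy hy' ht h1 h2 h3 h4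
    rcases lt_or_ge (x + y) 0 with hneg | hnonneg
    · refine ⟨-(x + y) / 2, by linarith, ?_⟩
      intros
      linarith
    rcases le_or_gt 1 (x + y) with hone | hone
    · refine ⟨1, one_pos, fun x' y' t hx _ hy _ ht h1 h2 h3 h4 => hxy ⟨t, ht, ?_⟩⟩
      refine ⟨?_, ?_, ?_, ?_⟩ <;> linarith
    · have hx : x ∉ {t : ℝ | (t, -t) ∈ D} := fun h =>
        hxy ⟨x, h, le_rfl, by linarith, by linarith, by linarith⟩
      have hy : -y ∉ {t : ℝ | (t, -t) ∈ D} := fun h =>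
        hxy ⟨-y, h, by linarith, by linarith, by linarith, by linarith⟩
      obtain ⟨ε, hε, hεx⟩ := exists_pos_forall_mem_le_abs_sub hT hx
      obtain ⟨δ, hδ, hδy⟩ := exists_pos_forall_mem_le_abs_sub hT hy
      refine ⟨min ε δ, lt_min hε hδ, fun x' y' t hx hx' hy hy' ht h1 h2 h3 h4 => ?_⟩
      have hmin_left := min_le_left ε δ
      have hmin_right := min_le_right ε δ
      refine hxy ⟨t, ht, ?_, by linarith, ?_, by linarith⟩
      · by_contra! hlt
        have := hεx t ht
        rw [abs_of_pos (by linarith)] at this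
        linarith
      · by_contra! hlt
        have := hδy t ht
        rw [abs_of_neg (by linarith)] at this
        linarith
  · ext ⟨x, y⟩
    rw [mem_inter_iff, hmem]
    constructor
    · rintro ⟨⟨t, ht, h1, _, h3, _⟩, h⟩
      obtain rfl : y = -x := h
      obtain rfl : t = x := by linarith
      exact ht
    · intro h
      obtain rfl : y = -x := hD h
      exact ⟨⟨x, h, le_rfl, by linarith, le_rfl, by linarith⟩, rfl⟩
end

section
/- A set E ⊆ ℝ² is countable and a Gδ-set in the Euclidean topology of ℝ² if and only if E is scattered in ℝ², i.e., every nonempty subset of E has a point that is isolated in that subset's Euclidean subspace topology. -/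
open Topology Set

/-- In a locally compact Hausdorff space whose closed sets are Gδ, every nonempty subset of a
countable Gδ set has an isolated point. -/
theorem Set.Countable.exists_isolated_of_subset_isGδ {X : Type*} [TopologicalSpace X] [T2Space X]
    [LocallyCompactSpace X] (hclosed : ∀ s : Set X, IsClosed s → IsGδ s) {E A : Set X}
    (hc : E.Countable) (hG : IsGδ E) (hAE : A ⊆ E) (hA : A.Nonempty) :
    ∃ p ∈ A, ∃ U : Set X, IsOpen U ∧ U ∩ A = {p} := by
  have hCG : IsGδ (E ∩ closure A) := hG.inter (hclosed _ isClosed_closure)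
  have : BaireSpace ↥(E ∩ closure A) := hCG.baireSpace_of_t2Space_locallyCompactSpace
  have : Countable ↥(E ∩ closure A) := (hc.mono inter_subset_left).to_subtype
  have : Nonempty ↥(E ∩ closure A) := by
    obtain ⟨a, ha⟩ := hA
    exact ⟨⟨a, hAE ha, subset_closure ha⟩⟩
  obtain ⟨p, q, hq⟩ := nonempty_interior_of_iUnion_of_closed
    (f := fun p : ↥(E ∩ closure A) => {p}) (fun p => isClosed_singleton)
    (iUnion_of_singleton _)
  obtain ⟨W, hWp, hW, hqW⟩ := mem_interior.1 hq
  obtain ⟨U, hU, rfl⟩ := isOpen_induced_iff.1 hW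
  have hqp : q = p := hWp hqW
  subst hqp
  have heq : ∀ x ∈ U ∩ A, x = q := fun x hx =>
    congrArg Subtype.val (hWp (a := ⟨x, hAE hx.2, subset_closure hx.2⟩) hx.1)
  obtain ⟨y, hyU, hyA⟩ := mem_closure_iff.1 q.2.2 U hU hqW
  have hyq : y = q := heq y ⟨hyU, hyA⟩
  exact ⟨q, hyq ▸ hyA, U, hU, Subset.antisymm heq
    (singleton_subset_iff.2 ⟨hqW, hyq ▸ hyA⟩)⟩

/-- An induction principle for scattered sets: a predicate on basic open sets which holds at every
basic open set meeting the uncovered part of `E` in a single point covers `E`. -/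
theorem TopologicalSpace.IsTopologicalBasis.subset_sUnion_of_scattered {X : Type*}
    [TopologicalSpace X] {B : Set (Set X)} (hB : IsTopologicalBasis B) {E : Set X}
    (hE : ∀ A ⊆ E, A.Nonempty → ∃ p ∈ A, ∃ U : Set X, IsOpen U ∧ U ∩ A = {p})
    (P : Set X → Prop)
    (hP : ∀ b ∈ B, ∀ p ∈ E, (∀ x ∈ b, x ∈ E → x ∉ ⋃₀ {b ∈ B | P b} → x = p) → P b) :
    E ⊆ ⋃₀ {b ∈ B | P b} := by
  by_contra h
  obtain ⟨p, hp, U, hU, hUA⟩ := hE (E \ ⋃₀ {b ∈ B | P b}) sdiff_subset (sdiff_nonempty.2 h)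
  have hpU : p ∈ U := (hUA.ge rfl).1
  obtain ⟨b, hb, hpb, hbU⟩ := hB.exists_subset_of_mem_open hpU hU
  exact hp.2 ⟨b, ⟨hb, hP b hb p hp.1 fun x hx hxE hxV => hUA.le ⟨hbU hx, hxE, hxV⟩⟩, hpb⟩

/-- A scattered subset of a second countable space is countable. -/
theorem Set.countable_of_scattered {X : Type*} [TopologicalSpace X] [SecondCountableTopology X]
    {E : Set X}
    (hE : ∀ A ⊆ E, A.Nonempty → ∃ p ∈ A, ∃ U : Set X, IsOpen U ∧ U ∩ A = {p}) :
    E.Countable := by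
  let S := {b ∈ TopologicalSpace.countableBasis X | (b ∩ E).Countable}
  have hS : (⋃₀ S ∩ E).Countable := by
    rw [sUnion_eq_biUnion, iUnion₂_inter]
    exact ((TopologicalSpace.countable_countableBasis X).mono (sep_subset _ _)).biUnion
      fun b hb => hb.2
  have hES : E ⊆ ⋃₀ S :=
    (TopologicalSpace.isBasis_countableBasis X).subset_sUnion_of_scattered hE _
      fun b _ p _ h => (hS.insert p).mono fun x hx => by
        by_cases hxS : x ∈ ⋃₀ S
        · exact Or.inr ⟨hxS, hx.2⟩
        · exact Or.inl (h x hx.1 hx.2 hxS)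
  exact hS.mono (subset_inter hES Subset.rfl)

/-- A scattered subset of a second countable T₁ space whose closed sets are Gδ is Gδ. -/
theorem IsGδ.of_scattered {X : Type*} [TopologicalSpace X] [SecondCountableTopology X]
    [T1Space X] (hclosed : ∀ s : Set X, IsClosed s → IsGδ s) {E : Set X}
    (hE : ∀ A ⊆ E, A.Nonempty → ∃ p ∈ A, ∃ U : Set X, IsOpen U ∧ U ∩ A = {p}) :
    IsGδ E := by
  have hB := TopologicalSpace.isBasis_countableBasis X
  let S := {b ∈ TopologicalSpace.countableBasis X | IsGδ (bᶜ ∪ E)}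
  have hSo : IsOpen (⋃₀ S) := isOpen_sUnion fun b hb => hB.isOpen hb.1
  have hS : IsGδ ((⋃₀ S)ᶜ ∪ E) := by
    have : (⋃₀ S)ᶜ ∪ E = ⋂ b ∈ S, (bᶜ ∪ E) := by
      rw [← iInter₂_union, sUnion_eq_biUnion, compl_iUnion₂]
    rw [this]
    exact IsGδ.biInter ((TopologicalSpace.countable_countableBasis X).mono (sep_subset _ _))
      fun b hb => hb.2
  have hES : E ⊆ ⋃₀ S := hB.subset_sUnion_of_scattered hE _ fun b hb p hp h => by
    have hbc : IsGδ bᶜ := hclosed _ (hB.isOpen hb).isClosed_compl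
    have : bᶜ ∪ E = (bᶜ ∪ ((⋃₀ S)ᶜ ∪ E)) ∩ (bᶜ ∪ (⋃₀ S ∪ {p})) := by
      ext x
      have h1 := h x
      have h2 : x = p → x ∈ E := fun hx => hx ▸ hp
      change x ∈ b → x ∈ E → x ∉ ⋃₀ S → x = p at h1
      simp only [mem_union, mem_inter_iff, mem_compl_iff, mem_singleton_iff]
      tauto
    rw [this]
    exact (hbc.union hS).inter (hbc.union (hSo.isGδ.union (hclosed _ isClosed_singleton)))
  have : E = ⋃₀ S ∩ ((⋃₀ S)ᶜ ∪ E) := by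
    rw [inter_union_distrib_left, inter_compl_self, empty_union, inter_eq_right.2 hES]
  rw [this]
  exact hSo.isGδ.inter hS

/-- A subset of the Euclidean plane is countable and Gδ iff it is scattered:
every nonempty subset has a point isolated in that subset. -/
theorem countable_Gdelta_iff_scattered (E : Set (ℝ × ℝ)) :
    (E.Countable ∧ IsGδ E) ↔
      ∀ A ⊆ E, A.Nonempty →
        ∃ p ∈ A, ∃ U : Set (ℝ × ℝ), IsOpen U ∧ U ∩ A = {p} := by
  have hclosed : ∀ s : Set (ℝ × ℝ), IsClosed s → IsGδ s := fun _ hs => hs.isGδ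
  exact ⟨fun ⟨hc, hG⟩ _ hAE hA => hc.exists_isolated_of_subset_isGδ hclosed hG hAE hA,
    fun h => ⟨countable_of_scattered h, IsGδ.of_scattered hclosed h⟩⟩
end

section
/- Let X be a δ-normally separated topological space, i.e., every closed subset of X is completely separated from every functionally closed subset of X disjoint from it. Then X has the property (C* = C): every closed C*-embedded subset of X is C-embedded in X. -/
open Topology Set

/-- Every δ-normally separated space has the property (C* = C): every closed
C*-embedded subset is C-embedded. -/
theorem delta_normally_separated_cstar_eq_c {X : Type*} [t : TopologicalSpace X]
    (h : ∀ F Z : Set X, IsClosed F → FunctionallyClosedIn t Z → Disjoint F Z →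
      CompletelySeparatedIn t F Z) :
    ∀ E : Set X, IsClosed E → CStarEmbedded t E → CEmbedded t E := by
  intro E hE hCStar f hf
  obtain ⟨g, hg, hgf⟩ := hCStar (fun x => Real.arctan (f x)) (Real.continuous_arctan.comp hf)
    ⟨Real.pi / 2, fun x =>
      abs_le.2 ⟨(Real.neg_pi_div_two_lt_arctan _).le, (Real.arctan_lt_pi_div_two _).le⟩⟩
  have hZ : FunctionallyClosedIn t {x | Real.pi / 2 ≤ |g x|} := by
    refine ⟨fun x => min 1 (max 0 (Real.pi / 2 - |g x|)), by fun_prop, fun x => ?_, ?_⟩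
    · exact ⟨le_min zero_le_one (le_max_left _ _), min_le_left _ _⟩
    · ext x
      simp only [mem_ofPred_eq, mem_preimage, mem_singleton_iff]
      grind
  have hdisj : Disjoint E {x | Real.pi / 2 ≤ |g x|} := by
    refine Set.disjoint_left.2 fun x hx => ?_
    rw [mem_ofPred_eq, not_le, hgf ⟨x, hx⟩]
    exact abs_lt.2 ⟨Real.neg_pi_div_two_lt_arctan _, Real.arctan_lt_pi_div_two _⟩
  obtain ⟨u, hu, hu01, huE, huZ⟩ := h E _ hE hZ hdisj
  have hmem (x : X) : g x * (1 - u x) ∈ Ioo (-(Real.pi / 2)) (Real.pi / 2) := by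
    rw [mem_Ioo, ← abs_lt]
    by_cases hx : Real.pi / 2 ≤ |g x|
    · simp [huZ x hx, Real.pi_pos]
    · rw [abs_mul, abs_of_nonneg (sub_nonneg.2 (hu01 x).2)]
      exact (mul_le_of_le_one_right (abs_nonneg _) (sub_le_self _ (hu01 x).1)).trans_lt
        (not_le.1 hx)
  refine ⟨fun x => Real.tan (g x * (1 - u x)), ?_, fun x => ?_⟩
  · exact Real.continuousOn_tan_Ioo.comp_continuous (by fun_prop) hmem
  · simp [huE x x.2, hgf x, Real.tan_arctan]
end
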